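/- Let α > 0, let v : ℝ × ℝ → ℝ be a smooth solution of the nonlinear diffusion equation v_t + (1/2)·(v_x)² - α·v_xx = 0, and let u : ℝ × ℝ → ℝ be smooth with u(x,t) > 0 for all x, t, solving the linear equation u_t + v_x·u_x - α·u_xx = 0. Then φ(x,t) := -2α·log(u(x,t)) + v(x,t) is again a solution of the nonlinear diffusion equation φ_t + (1/2)·(φ_x)² - α·φ_xx = 0 on ℝ × ℝ. -/

import Mathlib

open Real Filter MeasureTheory

/-- Partial derivative in the first (space) variable. -/
noncomputable def pdx (f : ℝ × ℝ → ℝ) (x t : ℝ) : ℝ := deriv (fun y => f (y, t)) x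

/-- Partial derivative in the second (time) variable. -/
noncomputable def pdt (f : ℝ × ℝ → ℝ) (x t : ℝ) : ℝ := deriv (fun s => f (x, s)) t

/-- Second partial derivative in the first (space) variable. -/
noncomputable def pdxx (f : ℝ × ℝ → ℝ) (x t : ℝ) : ℝ := deriv (fun y => pdx f y t) x

theorem hasDerivAt_pdx {f : ℝ × ℝ → ℝ} (hf : ContDiff ℝ (⊤ : ℕ∞) f) (x t : ℝ) :
    HasDerivAt (fun y => f (y, t)) (pdx f x t) x := by
  have h : ContDiff ℝ (⊤ : ℕ∞) (fun y : ℝ => f (y, t)) := by fun_prop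
  exact (h.differentiable (by simp) x).hasDerivAt

theorem hasDerivAt_pdt {f : ℝ × ℝ → ℝ} (hf : ContDiff ℝ (⊤ : ℕ∞) f) (x t : ℝ) :
    HasDerivAt (fun s => f (x, s)) (pdt f x t) t := by
  have h : ContDiff ℝ (⊤ : ℕ∞) (fun s : ℝ => f (x, s)) := by fun_prop
  exact (h.differentiable (by simp) t).hasDerivAt

theorem hasDerivAt_pdxx {f : ℝ × ℝ → ℝ} (hf : ContDiff ℝ (⊤ : ℕ∞) f) (x t : ℝ) :
    HasDerivAt (fun y => pdx f y t) (pdxx f x t) x := by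
  have h : ContDiff ℝ (⊤ : ℕ∞) (fun y : ℝ => f (y, t)) := by fun_prop
  have h' : ContDiff ℝ (⊤ : ℕ∞) (deriv fun y : ℝ => f (y, t)) :=
    (contDiff_infty_iff_deriv.mp h).2
  exact (h'.differentiable (by simp) x).hasDerivAt

theorem nde_new_solution_generation (α : ℝ) (hα : 0 < α)
    (v : ℝ × ℝ → ℝ) (hv : ContDiff ℝ (⊤ : ℕ∞) v)
    (hvnde : ∀ x t : ℝ, pdt v x t + (1 / 2) * (pdx v x t) ^ 2 - α * pdxx v x t = 0)
    (u : ℝ × ℝ → ℝ) (hu : ContDiff ℝ (⊤ : ℕ∞) u) (hupos : ∀ x t : ℝ, 0 < u (x, t))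
    (hulin : ∀ x t : ℝ, pdt u x t + pdx v x t * pdx u x t - α * pdxx u x t = 0)
    (φ : ℝ × ℝ → ℝ)
    (hφ : φ = fun p => -2 * α * Real.log (u p) + v p) :
    ∀ x t : ℝ, pdt φ x t + (1 / 2) * (pdx φ x t) ^ 2 - α * pdxx φ x t = 0 := by
  subst hφ
  intro x t
  set φ : ℝ × ℝ → ℝ := fun p => -2 * α * Real.log (u p) + v p
  have hne (y s : ℝ) : u (y, s) ≠ 0 := (hupos y s).ne'
  have ht : pdt φ x t = -2 * α * (pdt u x t / u (x, t)) + pdt v x t :=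
    ((((hasDerivAt_pdt hu x t).log (hne x t)).const_mul (-2 * α)).add
      (hasDerivAt_pdt hv x t)).deriv
  have hx (y : ℝ) : pdx φ y t = -2 * α * (pdx u y t / u (y, t)) + pdx v y t :=
    ((((hasDerivAt_pdx hu y t).log (hne y t)).const_mul (-2 * α)).add
      (hasDerivAt_pdx hv y t)).deriv
  have hxx : pdxx φ x t = -2 * α * ((pdxx u x t * u (x, t) - pdx u x t * pdx u x t)
      / u (x, t) ^ 2) + pdxx v x t := by
    unfold pdxx
    rw [funext hx]
    exact ((((hasDerivAt_pdxx hu x t).div (hasDerivAt_pdx hu x t) (hne x t)).const_mul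
      (-2 * α)).add (hasDerivAt_pdxx hv x t)).deriv
  rw [ht, hx, hxx]
  have h0 := hne x t
  have hut : pdt u x t = α * pdxx u x t - pdx v x t * pdx u x t := by
    linear_combination hulin x t
  have hvt : pdt v x t = α * pdxx v x t - (1 / 2) * (pdx v x t) ^ 2 := by
    linear_combination hvnde x t
  rw [hut, hvt]
  field_simp
  ring
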